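/- arXiv:2205.08103 — 4 statements merged into one kernel-verified Lean document; each statement's English description precedes it below -/
import Mathlib

section
/- (Quasi-convexity of work functions) For every k-server instance on a metric space, every 0 ≤ t ≤ T, and all k-tuples X = (x_1,…,x_k) and Y = (y_1,…,y_k) of points of Ω, there exists a permutation σ of {1,…,k} such that: (i) for every subset S ⊆ {1,…,k}, w_t({x_i : i ∈ S} ∪ {y_{σ(i)} : i ∉ S}) + w_t({y_{σ(i)} : i ∈ S} ∪ {x_i : i ∉ S}) ≤ w_t(X) + w_t(Y), where w_t is evaluated on the indicated k-point multisets; and (ii) for every point p ∈ Ω, the number of indices i with x_i = y_{σ(i)} = p equals the minimum of the multiplicity of p in X and the multiplicity of p in Y (i.e., σ matches common points to themselves). -/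
open Finset

/-- Minimum-matching (Wasserstein) distance between two `k`-point configurations,
represented as `k`-tuples of points. -/
noncomputable def confDist {Ω : Type*} [MetricSpace Ω] {k : ℕ} (X Y : Fin k → Ω) : ℝ :=
  ⨅ σ : Equiv.Perm (Fin k), ∑ i, dist (X i) (Y (σ i))

/-- The work function at time `t` of the `k`-server instance with initial configuration
`X₀` and requests `r 1, r 2, …` (the value `r 0` is unused): the least cost of serving
the first `t` requests and then moving to the configuration `X`. -/
noncomputable def workFn {Ω : Type*} [MetricSpace Ω] (k : ℕ) (X₀ : Fin k → Ω)
    (r : ℕ → Ω) (t : ℕ) (X : Fin k → Ω) : ℝ :=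
  sInf { c : ℝ | ∃ Y : ℕ → Fin k → Ω, Y 0 = X₀ ∧
    (∀ i ∈ Finset.Icc 1 t, ∃ j, Y i j = r i) ∧
    c = (∑ i ∈ Finset.Icc 1 t, confDist (Y (i - 1)) (Y i)) + confDist (Y t) X }

/-- The offline optimum of the `k`-server instance with initial configuration `X₀`
and requests `r 1, …, r T`. -/
noncomputable def opt {Ω : Type*} [MetricSpace Ω] (k : ℕ) (X₀ : Fin k → Ω)
    (r : ℕ → Ω) (T : ℕ) : ℝ :=
  sInf { c : ℝ | ∃ Y : ℕ → Fin k → Ω, Y 0 = X₀ ∧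
    (∀ i ∈ Finset.Icc 1 T, ∃ j, Y i j = r i) ∧
    c = ∑ i ∈ Finset.Icc 1 T, confDist (Y (i - 1)) (Y i) }

/-- `OPT_t(Z)`: the least cost of serving the first `t` requests while ending
in the configuration `Z`. -/
noncomputable def optTo {Ω : Type*} [MetricSpace Ω] (k : ℕ) (X₀ : Fin k → Ω)
    (r : ℕ → Ω) (t : ℕ) (Z : Fin k → Ω) : ℝ :=
  sInf { c : ℝ | ∃ Y : ℕ → Fin k → Ω, Y 0 = X₀ ∧
    (∀ i ∈ Finset.Icc 1 t, ∃ j, Y i j = r i) ∧ Y t = Z ∧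
    c = ∑ i ∈ Finset.Icc 1 t, confDist (Y (i - 1)) (Y i) }

/-- `X 0, X 1, …, X T` is a run of the work function algorithm on the `k`-server
instance with initial configuration `X₀` and requests `r 1, …, r T`. -/
def IsWFARun {Ω : Type*} [MetricSpace Ω] (k : ℕ) (X₀ : Fin k → Ω)
    (r : ℕ → Ω) (T : ℕ) (X : ℕ → Fin k → Ω) : Prop :=
  X 0 = X₀ ∧ ∀ t, 1 ≤ t → t ≤ T →
    (∃ j, X t j = r t) ∧
    ∀ Z : Fin k → Ω, (∃ j, Z j = r t) →
      optTo k X₀ r t (X t) + confDist (X t) (X (t - 1)) ≤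
        optTo k X₀ r t Z + confDist Z (X (t - 1))

section ConfDist

variable {Ω : Type*} [MetricSpace Ω] {k : ℕ}

theorem confDist_le (X Y : Fin k → Ω) (σ : Equiv.Perm (Fin k)) :
    confDist X Y ≤ ∑ i, dist (X i) (Y (σ i)) :=
  ciInf_le (Set.finite_range _).bddBelow σ

theorem exists_confDist_eq (X Y : Fin k → Ω) :
    ∃ σ : Equiv.Perm (Fin k), ∑ i, dist (X i) (Y (σ i)) = confDist X Y :=
  exists_eq_ciInf_of_finite

theorem confDist_nonneg (X Y : Fin k → Ω) : 0 ≤ confDist X Y :=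
  Real.iInf_nonneg fun _ => Finset.sum_nonneg fun _ _ => dist_nonneg

theorem confDist_comp_perm (X Y : Fin k → Ω) (τ : Equiv.Perm (Fin k)) :
    confDist X (Y ∘ τ) = confDist X Y := by
  unfold confDist
  exact (Equiv.mulLeft τ).iInf_congr fun σ => rfl

/-- A matching of `Z` with `Z'` transports along optimal matchings to a matching of `X` with `Y`,
such that exchanges in `X, Y` cost no more than the original moves when they are
accompanied by the corresponding exchanges in `Z, Z'`. -/
theorem exists_perm_confDist_piecewise_le (Z Z' X Y : Fin k → Ω) (σ : Equiv.Perm (Fin k)) :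
    ∃ σ' : Equiv.Perm (Fin k), ∀ S : Finset (Fin k), ∃ S' : Finset (Fin k),
      confDist (S'.piecewise Z (Z' ∘ σ)) (S.piecewise X (Y ∘ σ')) +
        confDist (S'.piecewise (Z' ∘ σ) Z) (S.piecewise (Y ∘ σ') X) ≤
        confDist Z X + confDist Z' Y := by
  obtain ⟨τ, hτ⟩ := exists_confDist_eq Z X
  obtain ⟨τ', hτ'⟩ := exists_confDist_eq Z' Y
  refine ⟨(τ.symm.trans σ).trans τ', fun S => ⟨Finset.univ.filter fun i => τ i ∈ S, ?_⟩⟩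
  refine (add_le_add (confDist_le _ _ τ) (confDist_le _ _ τ)).trans ?_
  rw [← hτ, ← hτ', ← Equiv.sum_comp σ fun i => dist (Z' i) (Y (τ' i)),
    ← Finset.sum_add_distrib, ← Finset.sum_add_distrib]
  refine Finset.sum_le_sum fun i _ => ?_
  by_cases h : τ i ∈ S
  · simp [Finset.piecewise, h]
  · simp [Finset.piecewise, h, add_comm]

end ConfDist

section Exchange

variable {Ω : Type*} {k : ℕ}

/-- Swapping any set of coordinates between `X` and `Y ∘ σ` does not increase `f X + f Y`. -/
def IsExchange (f : (Fin k → Ω) → ℝ) (X Y : Fin k → Ω) (σ : Equiv.Perm (Fin k)) : Prop :=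
  ∀ S : Finset (Fin k), f (S.piecewise X (Y ∘ σ)) + f (S.piecewise (Y ∘ σ) X) ≤ f X + f Y

/-- An exchange permutation can be modified so as to match one more pair of equal points. -/
theorem IsExchange.swap {f : (Fin k → Ω) → ℝ}
    (hf : ∀ (X : Fin k → Ω) (τ : Equiv.Perm (Fin k)), f (X ∘ τ) = f X)
    {X Y : Fin k → Ω} {σ : Equiv.Perm (Fin k)} (h : IsExchange f X Y σ) {i j : Fin k}
    (hij : X i = Y (σ j)) : IsExchange f X Y (σ * Equiv.swap i j) := by
  intro S
  rcases eq_or_ne i j with rfl | hne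
  · simpa using h S
  by_cases hi : i ∈ S <;> by_cases hj : j ∈ S
  · have e₁ : S.piecewise X (Y ∘ ⇑(σ * Equiv.swap i j)) = S.piecewise X (Y ∘ σ) := by
      ext l
      by_cases hl : l ∈ S
      · simp [hl]
      · have : l ≠ i := by rintro rfl; exact hl hi
        have : l ≠ j := by rintro rfl; exact hl hj
        simp [Equiv.swap_apply_of_ne_of_ne, *]
    have e₂ : S.piecewise (Y ∘ ⇑(σ * Equiv.swap i j)) X =
        S.piecewise (Y ∘ σ) X ∘ Equiv.swap i j := by
      ext l
      rcases eq_or_ne l i with rfl | hli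
      · simp [hi, hj]
      rcases eq_or_ne l j with rfl | hlj
      · simp [hi, hj]
      by_cases hl : l ∈ S <;> simp [hl, Equiv.swap_apply_of_ne_of_ne hli hlj]
    rw [e₁, e₂, hf]
    exact h S
  · have e₁ : S.piecewise X (Y ∘ ⇑(σ * Equiv.swap i j)) =
        (S.erase i).piecewise X (Y ∘ σ) ∘ Equiv.swap i j := by
      ext l
      rcases eq_or_ne l i with rfl | hli
      · simp [hi, hj, hij]
      rcases eq_or_ne l j with rfl | hlj
      · simp [hj]
      by_cases hl : l ∈ S <;>
        simp [Finset.piecewise, hl, hli, Equiv.swap_apply_of_ne_of_ne hli hlj]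
    have e₂ : S.piecewise (Y ∘ ⇑(σ * Equiv.swap i j)) X =
        (S.erase i).piecewise (Y ∘ σ) X := by
      ext l
      rcases eq_or_ne l i with rfl | hli
      · simp [hi, hij]
      rcases eq_or_ne l j with rfl | hlj
      · simp [hj]
      by_cases hl : l ∈ S <;>
        simp [Finset.piecewise, hl, hli, Equiv.swap_apply_of_ne_of_ne hli hlj]
    rw [e₁, e₂, hf]
    exact h _
  · have e₁ : S.piecewise X (Y ∘ ⇑(σ * Equiv.swap i j)) =
        (insert i S).piecewise X (Y ∘ σ) := by
      ext l
      rcases eq_or_ne l i with rfl | hli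
      · simp [hi, hij]
      rcases eq_or_ne l j with rfl | hlj
      · simp [hj]
      by_cases hl : l ∈ S <;>
        simp [Finset.piecewise, hl, hli, Equiv.swap_apply_of_ne_of_ne hli hlj]
    have e₂ : S.piecewise (Y ∘ ⇑(σ * Equiv.swap i j)) X =
        (insert i S).piecewise (Y ∘ σ) X ∘ Equiv.swap i j := by
      ext l
      rcases eq_or_ne l i with rfl | hli
      · simp [hi, hj, hij]
      rcases eq_or_ne l j with rfl | hlj
      · simp [hj]
      by_cases hl : l ∈ S <;>
        simp [Finset.piecewise, hl, hli, Equiv.swap_apply_of_ne_of_ne hli hlj]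
    rw [e₁, e₂, hf]
    exact h _
  · have e₁ : S.piecewise X (Y ∘ ⇑(σ * Equiv.swap i j)) =
        S.piecewise X (Y ∘ σ) ∘ Equiv.swap i j := by
      ext l
      rcases eq_or_ne l i with rfl | hli
      · simp [hi, hj]
      rcases eq_or_ne l j with rfl | hlj
      · simp [hi, hj]
      by_cases hl : l ∈ S <;> simp [hl, Equiv.swap_apply_of_ne_of_ne hli hlj]
    have e₂ : S.piecewise (Y ∘ ⇑(σ * Equiv.swap i j)) X = S.piecewise (Y ∘ σ) X := by
      ext l
      by_cases hl : l ∈ S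
      · have : l ≠ i := by rintro rfl; exact hi hl
        have : l ≠ j := by rintro rfl; exact hj hl
        simp [Equiv.swap_apply_of_ne_of_ne, *]
      · simp [hl]
    rw [e₁, e₂, hf]
    exact h S

/-- `σ` matches the common points of `X` and `Y`, with multiplicity, to themselves. -/
def MatchesCommon [DecidableEq Ω] (X Y : Fin k → Ω) (σ : Equiv.Perm (Fin k)) : Prop :=
  ∀ p : Ω, (Finset.univ.filter fun i => X i = p ∧ Y (σ i) = p).card =
    min ((Finset.univ.filter fun i => X i = p).card) ((Finset.univ.filter fun i => Y i = p).card)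

theorem IsExchange.exists_matchesCommon [DecidableEq Ω] {f : (Fin k → Ω) → ℝ}
    (hf : ∀ (X : Fin k → Ω) (τ : Equiv.Perm (Fin k)), f (X ∘ τ) = f X)
    {X Y : Fin k → Ω} (h : ∃ σ, IsExchange f X Y σ) :
    ∃ σ, IsExchange f X Y σ ∧ MatchesCommon X Y σ := by
  obtain ⟨σ, hσ, hmax⟩ := (Set.toFinite {σ | IsExchange f X Y σ}).exists_maximalFor
    (fun σ => (Finset.univ.filter fun i => X i = Y (σ i)).card) _ h
  refine ⟨σ, hσ, fun p => ?_⟩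
  have hcard : (Finset.univ.filter fun i => Y (σ i) = p).card =
      (Finset.univ.filter fun i => Y i = p).card :=
    Finset.card_equiv σ (by simp)
  rw [← hcard]
  by_contra hne
  have hX : (Finset.univ.filter fun i => X i = p ∧ Y (σ i) = p) ⊆
      Finset.univ.filter fun i => X i = p := fun i => by simp +contextual
  have hY : (Finset.univ.filter fun i => X i = p ∧ Y (σ i) = p) ⊆
      Finset.univ.filter fun i => Y (σ i) = p := fun i => by simp +contextual
  have hlt := lt_of_le_of_ne
    (le_min (Finset.card_le_card hX) (Finset.card_le_card hY)) hne
  obtain ⟨i, hi, hi'⟩ := Finset.exists_mem_notMem_of_card_lt_card (lt_min_iff.1 hlt).1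
  obtain ⟨j, hj, hj'⟩ := Finset.exists_mem_notMem_of_card_lt_card (lt_min_iff.1 hlt).2
  simp only [Finset.mem_filter, Finset.mem_univ, true_and, not_and] at hi hi' hj hj'
  have hYi := hi' hi
  have hXj : X j ≠ p := fun h => hj' h hj
  have hsub : (Finset.univ.filter fun l => X l = Y (σ l)) ⊂
      Finset.univ.filter fun l => X l = Y ((σ * Equiv.swap i j) l) := by
    refine Finset.ssubset_iff_of_subset (fun l hl => ?_) |>.2 ⟨i, ?_, ?_⟩
    · simp only [Finset.mem_filter, Finset.mem_univ, true_and] at hl ⊢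
      have hli : l ≠ i := by rintro rfl; exact hYi (hl ▸ hi)
      have hlj : l ≠ j := by rintro rfl; exact hXj (hl.trans hj)
      simpa [Equiv.swap_apply_of_ne_of_ne hli hlj] using hl
    · exact Finset.mem_filter.2 ⟨Finset.mem_univ _, by simp [hi, hj]⟩
    · simpa [hi] using Ne.symm hYi
  have hle := hmax (hσ.swap hf (hi.trans hj.symm)) (Finset.card_le_card hsub.subset)
  exact absurd (Finset.card_lt_card hsub) (not_lt.2 hle)

/-- As there are finitely many permutations, approximate exchange permutations suffice. -/
theorem exists_isExchange_of_forall_pos {f : (Fin k → Ω) → ℝ} {X Y : Fin k → Ω}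
    (h : ∀ ε > 0, ∃ σ : Equiv.Perm (Fin k), ∀ S : Finset (Fin k),
      f (S.piecewise X (Y ∘ σ)) + f (S.piecewise (Y ∘ σ) X) < f X + f Y + ε) :
    ∃ σ, IsExchange f X Y σ := by
  by_contra! hcon
  simp only [IsExchange, not_forall, not_le] at hcon
  choose S hS using hcon
  obtain ⟨σ₀, hσ₀⟩ := Finite.exists_min fun σ : Equiv.Perm (Fin k) =>
    f ((S σ).piecewise X (Y ∘ σ)) + f ((S σ).piecewise (Y ∘ σ) X)
  obtain ⟨σ, hσ⟩ := h _ (sub_pos.2 (hS σ₀))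
  linarith [hσ (S σ), hσ₀ σ]

end Exchange

section WorkFn

variable {Ω : Type*} [MetricSpace Ω] {k : ℕ}

theorem workFn_zero (X₀ : Fin k → Ω) (r : ℕ → Ω) (X : Fin k → Ω) :
    workFn k X₀ r 0 X = confDist X₀ X := by
  have : { c : ℝ | ∃ Y : ℕ → Fin k → Ω, Y 0 = X₀ ∧
      (∀ i ∈ Finset.Icc 1 0, ∃ j, Y i j = r i) ∧
      c = (∑ i ∈ Finset.Icc 1 0, confDist (Y (i - 1)) (Y i)) + confDist (Y 0) X } =
      {confDist X₀ X} := by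
    ext c
    constructor
    · rintro ⟨Y, hY, -, rfl⟩
      simp [hY]
    · rintro rfl
      exact ⟨fun _ => X₀, rfl, by simp, by simp⟩
  rw [workFn, this, csInf_singleton]

theorem workFn_comp_perm (X₀ : Fin k → Ω) (r : ℕ → Ω) (t : ℕ) (X : Fin k → Ω)
    (τ : Equiv.Perm (Fin k)) : workFn k X₀ r t (X ∘ τ) = workFn k X₀ r t X := by
  simp only [workFn, confDist_comp_perm]

theorem workFn_le (X₀ : Fin k → Ω) (r : ℕ → Ω) (t : ℕ) (X : Fin k → Ω) (Y : ℕ → Fin k → Ω)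
    (h₀ : Y 0 = X₀) (hr : ∀ i ∈ Finset.Icc 1 t, ∃ j, Y i j = r i) :
    workFn k X₀ r t X ≤
      (∑ i ∈ Finset.Icc 1 t, confDist (Y (i - 1)) (Y i)) + confDist (Y t) X := by
  refine csInf_le ⟨0, ?_⟩ ⟨Y, h₀, hr, rfl⟩
  rintro c ⟨Y, -, -, rfl⟩
  exact add_nonneg (Finset.sum_nonneg fun _ _ => confDist_nonneg _ _) (confDist_nonneg _ _)

theorem exists_schedule_lt_workFn_add (hk : 1 ≤ k) (X₀ : Fin k → Ω) (r : ℕ → Ω) (t : ℕ)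
    (X : Fin k → Ω) {ε : ℝ} (hε : 0 < ε) :
    ∃ Y : ℕ → Fin k → Ω, Y 0 = X₀ ∧ (∀ i ∈ Finset.Icc 1 t, ∃ j, Y i j = r i) ∧
      (∑ i ∈ Finset.Icc 1 t, confDist (Y (i - 1)) (Y i)) + confDist (Y t) X <
        workFn k X₀ r t X + ε := by
  have hne : { c : ℝ | ∃ Y : ℕ → Fin k → Ω, Y 0 = X₀ ∧
      (∀ i ∈ Finset.Icc 1 t, ∃ j, Y i j = r i) ∧
      c = (∑ i ∈ Finset.Icc 1 t, confDist (Y (i - 1)) (Y i)) + confDist (Y t) X }.Nonempty := by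
    refine ⟨_, fun i => if i = 0 then X₀ else fun _ => r i, by simp, fun i hi => ?_, rfl⟩
    have : i ≠ 0 := by have := (Finset.mem_Icc.1 hi).1; omega
    exact ⟨⟨0, hk⟩, by simp [this]⟩
  obtain ⟨c, ⟨Y, h₀, hr, rfl⟩, hlt⟩ := exists_lt_of_csInf_lt hne (lt_add_of_pos_right _ hε)
  exact ⟨Y, h₀, hr, hlt⟩

theorem workFn_succ_le (hk : 1 ≤ k) (X₀ : Fin k → Ω) (r : ℕ → Ω) (t : ℕ) (X Z : Fin k → Ω)
    (hZ : ∃ j, Z j = r (t + 1)) :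
    workFn k X₀ r (t + 1) X ≤ workFn k X₀ r t Z + confDist Z X := by
  refine le_of_forall_pos_le_add fun ε hε => ?_
  obtain ⟨Y, h₀, hr, hlt⟩ := exists_schedule_lt_workFn_add hk X₀ r t Z hε
  have hle := workFn_le X₀ r (t + 1) X (fun i => if i = t + 1 then Z else Y i) (by simpa)
    (fun i hi => by
      by_cases h : i = t + 1
      · simpa [h] using hZ
      · have := Finset.mem_Icc.1 hi
        simpa [h] using hr i (Finset.mem_Icc.2 ⟨this.1, by omega⟩))
  rw [Finset.sum_Icc_succ_top (by omega)] at hle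
  have hsum : ∑ i ∈ Finset.Icc 1 t, confDist (if i - 1 = t + 1 then Z else Y (i - 1))
      (if i = t + 1 then Z else Y i) = ∑ i ∈ Finset.Icc 1 t, confDist (Y (i - 1)) (Y i) := by
    refine Finset.sum_congr rfl fun i hi => ?_
    have := Finset.mem_Icc.1 hi
    rw [if_neg (by omega), if_neg (by omega)]
  rw [hsum] at hle
  simp only [Nat.add_sub_cancel, if_true, if_neg (Nat.lt_succ_self t).ne] at hle
  linarith

theorem exists_workFn_add_confDist_lt (hk : 1 ≤ k) (X₀ : Fin k → Ω) (r : ℕ → Ω) (t : ℕ)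
    (X : Fin k → Ω) {ε : ℝ} (hε : 0 < ε) :
    ∃ Z : Fin k → Ω, (∃ j, Z j = r (t + 1)) ∧
      workFn k X₀ r t Z + confDist Z X < workFn k X₀ r (t + 1) X + ε := by
  obtain ⟨Y, h₀, hr, hlt⟩ := exists_schedule_lt_workFn_add hk X₀ r (t + 1) X hε
  refine ⟨Y (t + 1), hr _ (by simp), ?_⟩
  rw [Finset.sum_Icc_succ_top (by omega), Nat.add_sub_cancel] at hlt
  have := workFn_le X₀ r t (Y (t + 1)) Y h₀ fun i hi => hr i <| by
    have := Finset.mem_Icc.1 hi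
    exact Finset.mem_Icc.2 ⟨this.1, by omega⟩
  linarith

theorem exists_isExchange_workFn [DecidableEq Ω] (hk : 1 ≤ k) (X₀ : Fin k → Ω) (r : ℕ → Ω)
    (t : ℕ) (X Y : Fin k → Ω) : ∃ σ, IsExchange (workFn k X₀ r t) X Y σ := by
  induction t generalizing X Y with
  | zero =>
    obtain ⟨σ, hσ⟩ := exists_perm_confDist_piecewise_le X₀ X₀ X Y 1
    refine ⟨σ, fun S => ?_⟩
    obtain ⟨S', hS'⟩ := hσ S
    simpa [workFn_zero, Finset.piecewise_same] using hS'
  | succ t ih =>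
    refine exists_isExchange_of_forall_pos fun ε hε => ?_
    obtain ⟨Z, ⟨a, ha⟩, hZ⟩ := exists_workFn_add_confDist_lt hk X₀ r t X (half_pos hε)
    obtain ⟨Z', ⟨b, hb⟩, hZ'⟩ := exists_workFn_add_confDist_lt hk X₀ r t Y (half_pos hε)
    obtain ⟨σ, hσ, hcommon⟩ :=
      IsExchange.exists_matchesCommon (workFn_comp_perm X₀ r t) (ih Z Z')
    obtain ⟨l, hl⟩ : (Finset.univ.filter fun i => Z i = r (t + 1) ∧
        Z' (σ i) = r (t + 1)).Nonempty := by
      rw [← Finset.card_pos, hcommon, lt_min_iff]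
      exact ⟨Finset.card_pos.2 ⟨a, by simpa⟩, Finset.card_pos.2 ⟨b, by simpa⟩⟩
    simp only [Finset.mem_filter, Finset.mem_univ, true_and] at hl
    obtain ⟨σ', hσ'⟩ := exists_perm_confDist_piecewise_le Z Z' X Y σ
    refine ⟨σ', fun S => ?_⟩
    obtain ⟨S', hS'⟩ := hσ' S
    have h₁ := workFn_succ_le hk X₀ r t (S.piecewise X (Y ∘ σ')) (S'.piecewise Z (Z' ∘ σ))
      ⟨l, by by_cases h : l ∈ S' <;> simp [h, hl]⟩
    have h₂ := workFn_succ_le hk X₀ r t (S.piecewise (Y ∘ σ') X) (S'.piecewise (Z' ∘ σ) Z)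
      ⟨l, by by_cases h : l ∈ S' <;> simp [h, hl]⟩
    linarith [hσ S']

end WorkFn

/-- Quasi-convexity of work functions: there is a permutation `σ` such that swapping
any subset of the coordinates between `X` and `Y ∘ σ` does not increase
`w_t(X) + w_t(Y)`, and `σ` matches common points of `X` and `Y` to themselves. -/
theorem workFn_quasiconvex {Ω : Type*} [MetricSpace Ω] [DecidableEq Ω]
    (k : ℕ) (hk : 1 ≤ k) (X₀ : Fin k → Ω) (r : ℕ → Ω) (T t : ℕ) (htT : t ≤ T)
    (X Y : Fin k → Ω) :
    ∃ σ : Equiv.Perm (Fin k),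
      (∀ S : Finset (Fin k),
        workFn k X₀ r t (fun i => if i ∈ S then X i else Y (σ i)) +
          workFn k X₀ r t (fun i => if i ∈ S then Y (σ i) else X i) ≤
          workFn k X₀ r t X + workFn k X₀ r t Y) ∧
      (∀ p : Ω,
        (Finset.univ.filter fun i => X i = p ∧ Y (σ i) = p).card =
          min ((Finset.univ.filter fun i => X i = p).card)
            ((Finset.univ.filter fun i => Y i = p).card)) := by
  exact IsExchange.exists_matchesCommon (workFn_comp_perm X₀ r t)
    (exists_isExchange_workFn hk X₀ r t X Y)
end

section
/- (Antipodes in potentials) Let (Ω,d) be a metric space with antipodes of diameter Δ, let m ≥ 1, and let f : Ω^m × Ω^m → ℝ be 1-Lipschitz with respect to the sum metric (i.e., |f(X,Y) − f(X',Y')| ≤ Σ_{i=1}^m d(x_i,x'_i) + Σ_{j=1}^m d(y_j,y'_j)). Then inf over X = (x_1,…,x_m) and Y = (y_1,…,y_m) in Ω^m of [ f(X,Y) − Σ_{i=1}^m Σ_{j=1}^m d(x_i, y_j) ] equals inf over u ∈ Ω of f(u^m, ū^m) − m²Δ, where u^m denotes the m-tuple of copies of u and ū is the antipode of u. -/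
open Finset

/-- Among the points `x k` of two `m`-tuples, one has total distance to both tuples at most the
sum of all the cross distances. -/
theorem exists_sum_dist_add_sum_dist_le {Ω : Type*} [PseudoMetricSpace Ω] {m : ℕ} (hm : 1 ≤ m)
    (x z : Fin m → Ω) :
    ∃ k, (∑ i, dist (x i) (x k)) + ∑ j, dist (x k) (z j) ≤ ∑ i, ∑ j, dist (x i) (z j) := by
  set a : Fin m → ℝ := fun i => ∑ j, dist (x i) (z j)
  set S : ℝ := ∑ i, a i with hS
  have hS0 : 0 ≤ S := by positivity
  have hm0 : (0 : ℝ) < m := by exact_mod_cast hm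
  have hpair : ∀ k i, (m : ℝ) * dist (x i) (x k) ≤ a i + a k - if i = k then 2 * a i else 0 := by
    intro k i
    split_ifs with h
    · subst h
      simp only [dist_self]
      linarith
    · have htri : ∑ _j : Fin m, dist (x i) (x k) ≤ ∑ j, (dist (x i) (z j) + dist (x k) (z j)) :=
        sum_le_sum fun j _ => dist_triangle_right _ _ _
      rw [sum_add_distrib] at htri
      simpa using htri
  have hD : (m : ℝ) * ∑ k, ∑ i, dist (x i) (x k) ≤ 2 * m * S - 2 * S := by
    calc (m : ℝ) * ∑ k, ∑ i, dist (x i) (x k)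
        = ∑ k, ∑ i, (m : ℝ) * dist (x i) (x k) := by simp only [mul_sum]
      _ ≤ ∑ k, ∑ i, (a i + a k - if i = k then 2 * a i else 0) :=
        sum_le_sum fun k _ => sum_le_sum fun i _ => hpair k i
      _ = 2 * m * S - 2 * S := by
        simp only [sum_sub_distrib, sum_add_distrib, sum_const, card_univ, Fintype.card_fin,
          nsmul_eq_mul, sum_ite_eq', mem_univ, if_true, ← mul_sum]
        ring
  have hfac : (0 : ℝ) ≤ (m - 1) * (m - 2) := by
    rcases hm.eq_or_lt with h | h
    · simp [← h]
    · have h2 : (2 : ℝ) ≤ m := by exact_mod_cast h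
      exact mul_nonneg (by linarith) (by linarith)
  have hsum : ∑ k, ((∑ i, dist (x i) (x k)) + a k) ≤ ∑ _k : Fin m, S := by
    rw [sum_add_distrib, ← hS, sum_const, card_univ, Fintype.card_fin, nsmul_eq_mul]
    refine le_of_mul_le_mul_left ?_ hm0
    nlinarith [mul_nonneg hfac hS0]
  obtain ⟨k, -, hk⟩ := exists_le_of_sum_le (univ_nonempty_iff.2 ⟨⟨0, hm⟩⟩) hsum
  exact ⟨k, hk⟩

/-- Antipodes in potentials: for a `1`-Lipschitz `f : Ω^m × Ω^m → ℝ` on a metric space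
with antipodes of diameter `Δ`,
`inf_{X,Y} (f(X,Y) − Σ_i Σ_j d(x_i,y_j)) = inf_u f(u^m, ū^m) − m²Δ`. -/
theorem antipodes_in_potentials {Ω : Type*} [MetricSpace Ω] [Nonempty Ω]
    (Δ : ℝ) (bar : Ω → Ω) (hbar : ∀ x y : Ω, dist x y + dist y (bar x) = Δ)
    (m : ℕ) (hm : 1 ≤ m) (f : (Fin m → Ω) → (Fin m → Ω) → ℝ)
    (hf : ∀ X Y X' Y' : Fin m → Ω,
      |f X Y - f X' Y'| ≤ (∑ i, dist (X i) (X' i)) + ∑ j, dist (Y j) (Y' j)) :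
    (⨅ (X : Fin m → Ω) (Y : Fin m → Ω),
        (f X Y - ∑ i, ∑ j, dist (X i) (Y j))) =
      (⨅ u : Ω, f (fun _ => u) (fun _ => bar u)) - (m : ℝ)^2 * Δ := by
  have hle : ∀ x y : Ω, dist x y ≤ Δ := fun x y => by
    linarith [hbar x y, dist_nonneg (x := y) (y := bar x)]
  have hsum_le : ∀ X X' : Fin m → Ω, ∑ i, dist (X i) (X' i) ≤ m * Δ := fun X X' =>
    (sum_le_sum fun i _ => hle (X i) (X' i)).trans_eq (by simp)
  have ⟨o⟩ := ‹Nonempty Ω›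
  have hf_ge : ∀ X Y, f (fun _ => o) (fun _ => o) - 2 * m * Δ ≤ f X Y := fun X Y => by
    linarith [le_abs_self (f (fun _ => o) (fun _ => o) - f X Y), hf (fun _ => o) (fun _ => o) X Y,
      hsum_le (fun _ => o) X, hsum_le (fun _ => o) Y]
  have hcross : ∀ X Y : Fin m → Ω, ∑ i, ∑ j, dist (X i) (Y j) ≤ (m : ℝ) ^ 2 * Δ := fun X Y =>
    (sum_le_sum fun i _ => hsum_le (fun _ => X i) Y).trans_eq (by simp; ring)
  have hlower : ∀ X Y, f (fun _ => o) (fun _ => o) - 2 * m * Δ - (m : ℝ) ^ 2 * Δ ≤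
      f X Y - ∑ i, ∑ j, dist (X i) (Y j) := fun X Y => by
    linarith [hf_ge X Y, hcross X Y]
  have hbdd : BddBelow (Set.range fun u : Ω => f (fun _ => u) (fun _ => bar u)) :=
    ⟨_, Set.forall_mem_range.2 fun u => hf_ge _ _⟩
  apply le_antisymm
  · rw [le_sub_iff_add_le]
    refine le_ciInf fun u => ?_
    rw [← le_sub_iff_add_le]
    refine (ciInf_le_of_le ⟨_, Set.forall_mem_range.2 fun X => le_ciInf (hlower X)⟩ (fun _ => u)
      (ciInf_le ⟨_, Set.forall_mem_range.2 (hlower _)⟩ fun _ => bar u)).trans_eq ?_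
    have hu : dist u (bar u) = Δ := by simpa using hbar u u
    simp only [hu, sum_const, card_univ, Fintype.card_fin, nsmul_eq_mul]
    ring
  · refine le_ciInf fun X => le_ciInf fun Y => ?_
    obtain ⟨k, hk⟩ := exists_sum_dist_add_sum_dist_le hm X fun j => bar (Y j)
    have hanti : ∀ j, dist (Y j) (bar (X k)) = dist (X k) (bar (Y j)) := fun j => by
      linarith [hbar (X k) (Y j), hbar (Y j) (X k), dist_comm (X k) (Y j)]
    have hcompl : ∑ i, ∑ j, dist (X i) (bar (Y j)) =
        (m : ℝ) ^ 2 * Δ - ∑ i, ∑ j, dist (X i) (Y j) := by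
      have h : ∀ i j, dist (X i) (bar (Y j)) = Δ - dist (X i) (Y j) := fun i j => by
        linarith [hbar (Y j) (X i), dist_comm (X i) (Y j)]
      simp only [h, sum_sub_distrib, sum_const, card_univ, Fintype.card_fin, nsmul_eq_mul]
      ring
    have hlip := hf X Y (fun _ => X k) (fun _ => bar (X k))
    simp only [hanti] at hlip
    linarith [ciInf_le hbdd (X k), neg_abs_le (f X Y - f (fun _ => X k) (fun _ => bar (X k)))]
end

section
/- (Antipodes in potentials, multi-block version) Let (Ω,d) be a metric space with antipodes of diameter Δ, let ℓ ≥ 1 and m_1,…,m_ℓ ≥ 1, and let f : Ω^{m_1} × Ω^{m_1} × ⋯ × Ω^{m_ℓ} × Ω^{m_ℓ} → ℝ be 1-Lipschitz with respect to the sum metric (sum of coordinate distances). Then inf over tuples X_i, Y_i ∈ Ω^{m_i} (i = 1,…,ℓ) of [ f(X_1,Y_1,…,X_ℓ,Y_ℓ) − Σ_{i=1}^ℓ Σ_{x ∈ X_i} Σ_{y ∈ Y_i} d(x,y) ] equals inf over (u_1,…,u_ℓ) ∈ Ω^ℓ of f(u_1^{m_1}, ū_1^{m_1}, …, u_ℓ^{m_ℓ},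 ū_ℓ^{m_ℓ}) − Δ·Σ_{i=1}^ℓ m_i², where u^m denotes the m-tuple of copies of u and ū is the antipode of u. -/
open Finset

/-- In a space with antipodes of diameter `Δ`, every triangle has perimeter at most `2 * Δ`. -/
lemma perimeter_le_of_antipodes {Ω : Type*} [PseudoMetricSpace Ω] {Δ : ℝ} {bar : Ω → Ω}
    (hbar : ∀ x y : Ω, dist x y + dist y (bar x) = Δ) (x y z : Ω) :
    dist x y + dist x z + dist y z ≤ 2 * Δ := by
  have := dist_triangle_right x y (bar z)
  linarith [hbar z x, hbar z y, dist_comm z x, dist_comm z y]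

/-- The perimeter bound summed over all triangles `(x i, x j, y k)` with `i ≠ j`. -/
lemma sum_dist_add_sum_dist_le {Ω : Type*} [PseudoMetricSpace Ω] {Δ : ℝ} {bar : Ω → Ω}
    (hbar : ∀ x y : Ω, dist x y + dist y (bar x) = Δ) {n : ℕ} (x y : Fin n → Ω) :
    n * ∑ i, ∑ j, dist (x i) (x j) + 2 * (n - 1) * ∑ i, ∑ k, dist (x i) (y k) ≤
      2 * Δ * n ^ 2 * (n - 1) := by
  have key : ∑ i, ∑ j, ∑ k, (dist (x i) (x j) + dist (x i) (y k) + dist (x j) (y k)) ≤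
      ∑ i, ∑ j, ∑ k, (2 * Δ - if i = j then 2 * Δ - 2 * dist (x i) (y k) else 0) := by
    refine sum_le_sum fun i _ => sum_le_sum fun j _ => sum_le_sum fun k _ => ?_
    split_ifs with h
    · subst h
      rw [dist_self]
      linarith
    · linarith [perimeter_le_of_antipodes hbar (x i) (x j) (y k)]
  have diag (i : Fin n) : ∑ j, ∑ k, (if i = j then 2 * Δ - 2 * dist (x i) (y k) else 0) =
      ∑ k, (2 * Δ - 2 * dist (x i) (y k)) := by
    rw [sum_comm]
    simp
  simp only [sum_sub_distrib, diag] at key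
  simp only [sum_add_distrib, sum_const, card_univ, Fintype.card_fin,
    nsmul_eq_mul, ← mul_sum] at key
  linarith

/-- Some point `u` among the `x j` is such that replacing every `x j` by `u` and every `y j` by
its antipode costs no more in distance than the potential gains. -/
lemma exists_antipodal_collapse {Ω : Type*} [PseudoMetricSpace Ω] {Δ : ℝ} {bar : Ω → Ω}
    (hbar : ∀ x y : Ω, dist x y + dist y (bar x) = Δ) {n : ℕ} (hn : 1 ≤ n) (x y : Fin n → Ω) :
    ∃ u : Ω, ∑ j, dist u (x j) + ∑ j, dist (bar u) (y j) + ∑ j, ∑ k, dist (x j) (y k) ≤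
      Δ * (n : ℝ) ^ 2 := by
  have : Nonempty (Fin n) := ⟨⟨0, hn⟩⟩
  have hxx : 2 * ∑ i, ∑ j, dist (x i) (x j) ≤ n * ∑ i, ∑ j, dist (x i) (x j) := by
    obtain rfl | h2 := hn.eq_or_lt
    · simp
    · have : (2 : ℝ) ≤ n := mod_cast h2
      gcongr
  have hbar' (u z : Ω) : dist (bar u) z = Δ - dist u z := by
    rw [dist_comm, ← hbar u z]
    ring
  obtain ⟨i, -, hi⟩ : ∃ i ∈ univ, ∑ j, dist (x i) (x j) + ∑ j, dist (bar (x i)) (y j) +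
      ∑ j, ∑ k, dist (x j) (y k) ≤ Δ * (n : ℝ) ^ 2 := by
    refine exists_le_of_sum_le univ_nonempty ?_
    simp only [hbar', sum_add_distrib, sum_sub_distrib, sum_const, card_univ, Fintype.card_fin,
      nsmul_eq_mul]
    linarith [sum_dist_add_sum_dist_le hbar x y]
  exact ⟨x i, hi⟩

/-- Antipodes in potentials, multi-block version. -/
theorem antipodes_in_potentials_multi {Ω : Type*} [MetricSpace Ω] [Nonempty Ω]
    (Δ : ℝ) (bar : Ω → Ω) (hbar : ∀ x y : Ω, dist x y + dist y (bar x) = Δ)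
    (l : ℕ) (hl : 1 ≤ l) (m : Fin l → ℕ) (hm : ∀ i, 1 ≤ m i)
    (f : (∀ i : Fin l, (Fin (m i) → Ω) × (Fin (m i) → Ω)) → ℝ)
    (hf : ∀ A B : ∀ i : Fin l, (Fin (m i) → Ω) × (Fin (m i) → Ω),
      |f A - f B| ≤ ∑ i, ((∑ j, dist ((A i).1 j) ((B i).1 j)) +
        ∑ j, dist ((A i).2 j) ((B i).2 j))) :
    (⨅ A : ∀ i : Fin l, (Fin (m i) → Ω) × (Fin (m i) → Ω),
        (f A - ∑ i, ∑ j, ∑ j', dist ((A i).1 j) ((A i).2 j'))) =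
      (⨅ u : Fin l → Ω, f (fun i => (fun _ => u i, fun _ => bar (u i)))) -
        Δ * ∑ i, ((m i : ℝ))^2 := by
  have hdist (x y : Ω) : dist x y ≤ Δ := by
    linarith [hbar x y, dist_nonneg (x := y) (y := bar x)]
  have hbdd : BddBelow (Set.range fun u : Fin l → Ω =>
      f (fun i => (fun _ => u i, fun _ => bar (u i)))) := by
    obtain ⟨p⟩ := ‹Nonempty Ω›
    refine ⟨f (fun _ => (fun _ => p, fun _ => p)) -
      ∑ i, ((∑ _j : Fin (m i), Δ) + ∑ _j : Fin (m i), Δ), ?_⟩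
    rintro _ ⟨u, rfl⟩
    have h := (le_abs_self _).trans (hf (fun _ => (fun _ => p, fun _ => p))
      (fun i => (fun _ => u i, fun _ => bar (u i))))
    have h' := h.trans (sum_le_sum fun i _ => add_le_add
      (sum_le_sum fun _ _ => hdist _ _) (sum_le_sum fun _ _ => hdist _ _))
    exact sub_le_comm.mp h'
  have hlower (A : ∀ i : Fin l, (Fin (m i) → Ω) × (Fin (m i) → Ω)) :
      (⨅ u : Fin l → Ω, f (fun i => (fun _ => u i, fun _ => bar (u i)))) -
        Δ * ∑ i, ((m i : ℝ))^2 ≤ f A - ∑ i, ∑ j, ∑ j', dist ((A i).1 j) ((A i).2 j') := by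
    choose u hu using fun i => exists_antipodal_collapse hbar (hm i) (A i).1 (A i).2
    have hinf := ciInf_le hbdd u
    have hlip := (le_abs_self _).trans
      (hf (fun i => (fun _ => u i, fun _ => bar (u i))) A)
    have hsum := sum_le_sum fun i (_ : i ∈ univ) => hu i
    rw [sum_add_distrib, ← mul_sum] at hsum
    linarith
  refine le_antisymm ?_ (le_ciInf hlower)
  rw [le_sub_iff_add_le]
  refine le_ciInf fun u => ?_
  have h := ciInf_le ⟨_, Set.forall_mem_range.mpr hlower⟩
    (fun i => (fun _ => u i, fun _ => bar (u i)))
  have hdiam (z : Ω) : dist z (bar z) = Δ := by simpa using hbar z z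
  have hval : ∑ i, ∑ _j : Fin (m i), ∑ _k : Fin (m i), dist (u i) (bar (u i)) =
      Δ * ∑ i, (m i : ℝ) ^ 2 := by
    simp only [hdiam, sum_const, card_univ, Fintype.card_fin, nsmul_eq_mul, mul_sum]
    exact sum_congr rfl fun i _ => by ring
  simp only [hval] at h
  linarith
end

section
/- Let (Ω,d) be a metric space with antipodes of diameter Δ and let w be a real-valued function on 3-point multisets of Ω that is 1-Lipschitz (|w(X) − w(Y)| ≤ d(X,Y) for the minimum-matching distance d on multisets). Then inf over u, x_{11}, x_{12}, x_{21}, x_{22}, x_{31}, x_{32} ∈ Ω of [ w({ū,ū,ū}) + w({u,x_{11},x_{12}}) + w({u,x_{21},x_{22}}) + w({u,x_{31},x_{32}}) − d(x_{12},x_{21}) − d(x_{22},x_{31}) − d(x_{32},x_{11}) − d(x_{11},x_{21}) − d(x_{21},x_{31}) − d(x_{31},x_{11}) ] equals inf over u, x, y, z ∈ Ω of [ w({ū,ū,ū}) + w({u,x,ȳ}) + w({u,y,z̄}) + w({u,z,x̄}) − d(x,y) − d(y,z) − d(z,x) ] − 3Δ, where x̄ denotes the antipode of x. -/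
open Finset

/-- The antipode `x̄ = x + Δ` of a point on the circle of circumference `2Δ`. -/
noncomputable def antip (Δ : ℝ) (x : AddCircle (2*Δ)) : AddCircle (2*Δ) := x + (Δ : ℝ)

/-- The set `P`: triples of circle points not contained in any open semicircle,
i.e. with `d(x,y) + d(y,z) + d(z,x) = 2Δ`. -/
def InP (Δ : ℝ) (x y z : AddCircle (2*Δ)) : Prop :=
  dist x y + dist y z + dist z x = 2*Δ

/-- The potential `Φ*(w,u,x,y,z) = w(ū³) + w(u x ȳ) + w(u y z̄) + w(u z x̄)`. -/
noncomputable def PhiStar (Δ : ℝ) (w : (Fin 3 → AddCircle (2*Δ)) → ℝ)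
    (u x y z : AddCircle (2*Δ)) : ℝ :=
  w ![antip Δ u, antip Δ u, antip Δ u] + w ![u, x, antip Δ y]
    + w ![u, y, antip Δ z] + w ![u, z, antip Δ x]

/-- `w(X)` resolves from the `i`-th point of the configuration `X` (w.r.t. the
last request `r`): `w(X) = w(X - X i + r) + d(X i, r)`. -/
def ResolvesFrom {Ω : Type*} [MetricSpace Ω] (w : (Fin 3 → Ω) → ℝ) (r : Ω)
    (X : Fin 3 → Ω) (i : Fin 3) : Prop :=
  w X = w (Function.update X i r) + dist (X i) r

theorem confDist_le_sum {Ω : Type*} [MetricSpace Ω] {k : ℕ} (X Y : Fin k → Ω) :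
    confDist X Y ≤ ∑ i, dist (X i) (Y i) :=
  ciInf_le (Set.finite_range fun σ : Equiv.Perm (Fin k) => ∑ i, dist (X i) (Y (σ i))).bddBelow 1

/-- In a space with antipodes of diameter `Δ`, all distances are at most `Δ`. -/
theorem dist_le_of_antipodes {Ω : Type*} [MetricSpace Ω] {Δ : ℝ} {bar : Ω → Ω}
    (hbar : ∀ x y : Ω, dist x y + dist y (bar x) = Δ) (x y : Ω) : dist x y ≤ Δ := by
  linarith [hbar x y, dist_nonneg (x := y) (y := bar x)]

/-- Replacing the last point of a configuration by the antipode of `y` changes a 1-Lipschitz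
function by at most the defect of the antipode constraint. -/
theorem le_add_of_replace_by_antipode {Ω : Type*} [MetricSpace Ω] {Δ : ℝ} {bar : Ω → Ω}
    (hbar : ∀ x y : Ω, dist x y + dist y (bar x) = Δ) {w : (Fin 3 → Ω) → ℝ}
    (hw : ∀ X Y : Fin 3 → Ω, |w X - w Y| ≤ confDist X Y) (u x a y : Ω) :
    w ![u, x, bar y] + dist a y ≤ w ![u, x, a] + Δ := by
  have h1 := (abs_le.1 ((hw ![u, x, a] ![u, x, bar y]).trans (confDist_le_sum _ _))).1
  simp [Fin.sum_univ_three] at h1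
  linarith [hbar y a, dist_comm a y]

/-- A 1-Lipschitz function on the triples of a space with antipodes is bounded below. -/
theorem exists_lower_bound_of_antipodes {Ω : Type*} [MetricSpace Ω] [Nonempty Ω] {Δ : ℝ}
    {bar : Ω → Ω} (hbar : ∀ x y : Ω, dist x y + dist y (bar x) = Δ) {w : (Fin 3 → Ω) → ℝ}
    (hw : ∀ X Y : Fin 3 → Ω, |w X - w Y| ≤ confDist X Y) : ∃ B : ℝ, ∀ X, B ≤ w X := by
  obtain ⟨p⟩ := ‹Nonempty Ω›
  refine ⟨w (fun _ => p) - 3 * Δ, fun X => ?_⟩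
  have h1 := (abs_le.1 ((hw X fun _ => p).trans (confDist_le_sum _ _))).1
  rw [Fin.sum_univ_three] at h1
  linarith [dist_le_of_antipodes hbar (X 0) p, dist_le_of_antipodes hbar (X 1) p,
    dist_le_of_antipodes hbar (X 2) p]

/-- A real infimum of a family bounded below is at most any upper bound of one of its members. -/
theorem ciInf_le_of_forall_ge {ι : Type*} {f : ι → ℝ} {c : ℝ} (B : ℝ) (i : ι) (h : f i ≤ c)
    (hB : ∀ j, B ≤ f j) : ⨅ j, f j ≤ c :=
  ciInf_le_of_le ⟨B, Set.forall_mem_range.2 hB⟩ i h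

/-- The canonical form of the potential of this paper: enforcing the antipode
constraints via distance penalty terms loses exactly `3Δ`. -/
theorem canonical_form_this_paper {Ω : Type*} [MetricSpace Ω] [Nonempty Ω]
    (Δ : ℝ) (bar : Ω → Ω) (hbar : ∀ x y : Ω, dist x y + dist y (bar x) = Δ)
    (w : (Fin 3 → Ω) → ℝ) (hw : ∀ X Y : Fin 3 → Ω, |w X - w Y| ≤ confDist X Y) :
    (⨅ (u : Ω) (x11 : Ω) (x12 : Ω) (x21 : Ω) (x22 : Ω) (x31 : Ω) (x32 : Ω),
        (w ![bar u, bar u, bar u] + w ![u, x11, x12] + w ![u, x21, x22] +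
            w ![u, x31, x32] -
          dist x12 x21 - dist x22 x31 - dist x32 x11 -
          dist x11 x21 - dist x21 x31 - dist x31 x11)) =
      (⨅ (u : Ω) (x : Ω) (y : Ω) (z : Ω),
        (w ![bar u, bar u, bar u] + w ![u, x, bar y] + w ![u, y, bar z] +
            w ![u, z, bar x] -
          dist x y - dist y z - dist z x)) - 3 * Δ := by
  obtain ⟨B, hB⟩ := exists_lower_bound_of_antipodes hbar hw
  have hd := dist_le_of_antipodes hbar
  have hf : ∀ u x11 x12 x21 x22 x31 x32 : Ω, 4 * B - 6 * Δ ≤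
      w ![bar u, bar u, bar u] + w ![u, x11, x12] + w ![u, x21, x22] + w ![u, x31, x32] -
        dist x12 x21 - dist x22 x31 - dist x32 x11 -
        dist x11 x21 - dist x21 x31 - dist x31 x11 := by
    intro u x11 x12 x21 x22 x31 x32
    linarith [hB ![bar u, bar u, bar u], hB ![u, x11, x12], hB ![u, x21, x22],
      hB ![u, x31, x32], hd x12 x21, hd x22 x31, hd x32 x11, hd x11 x21, hd x21 x31, hd x31 x11]
  have hg : ∀ u x y z : Ω, 4 * B - 3 * Δ ≤
      w ![bar u, bar u, bar u] + w ![u, x, bar y] + w ![u, y, bar z] + w ![u, z, bar x] -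
        dist x y - dist y z - dist z x := by
    intro u x y z
    linarith [hB ![bar u, bar u, bar u], hB ![u, x, bar y], hB ![u, y, bar z],
      hB ![u, z, bar x], hd x y, hd y z, hd z x]
  apply le_antisymm
  · rw [le_sub_iff_add_le]
    refine le_ciInf fun u => le_ciInf fun x => le_ciInf fun y => le_ciInf fun z => ?_
    rw [← le_sub_iff_add_le]
    let C := 4 * B - 6 * Δ
    refine ciInf_le_of_forall_ge C u (ciInf_le_of_forall_ge C x
      (ciInf_le_of_forall_ge C (bar y) (ciInf_le_of_forall_ge C y
      (ciInf_le_of_forall_ge C (bar z) (ciInf_le_of_forall_ge C z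
      (ciInf_le_of_forall_ge C (bar x) ?_ ?_) ?_) ?_) ?_) ?_) ?_) ?_
    · have h : ∀ p : Ω, dist (bar p) p = Δ := fun p => by
        have := hbar p p
        rwa [dist_self, zero_add, dist_comm] at this
      linarith [h x, h y, h z]
    all_goals
      intros
      repeat' refine le_ciInf fun _ => ?_
      apply hf
  · refine le_ciInf fun u => le_ciInf fun x11 => le_ciInf fun x12 => le_ciInf fun x21 =>
      le_ciInf fun x22 => le_ciInf fun x31 => le_ciInf fun x32 => ?_
    rw [sub_le_iff_le_add]
    let C := 4 * B - 3 * Δ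
    refine ciInf_le_of_forall_ge C u (ciInf_le_of_forall_ge C x11
      (ciInf_le_of_forall_ge C x21 (ciInf_le_of_forall_ge C x31 ?_ ?_) ?_) ?_) ?_
    · linarith [le_add_of_replace_by_antipode hbar hw u x11 x12 x21,
        le_add_of_replace_by_antipode hbar hw u x21 x22 x31,
        le_add_of_replace_by_antipode hbar hw u x31 x32 x11]
    all_goals
      intros
      repeat' refine le_ciInf fun _ => ?_
      apply hg
end
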